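/- If Ψ > k^{3/2}, then span{f̂_1,…,f̂_k} = span{f_1,…,f_k}; in particular, each eigenvector f_i with i ∈ {1,…,k} can be expressed as f_i = ∑_{j=1}^k β_j^{(i)}·f̂_j for suitable real coefficients β_j^{(i)}. -/

import Mathlib

open Finset BigOperators Matrix

namespace SpectralClustering

variable {V : Type} [Fintype V] [DecidableEq V]

/-- Volume of a vertex set: the sum of the degrees of its vertices. -/
def vol (G : SimpleGraph V) [DecidableRel G.Adj] (S : Finset V) : ℕ :=
  ∑ v ∈ S, G.degree v

/-- Number of edges between two (disjoint) vertex sets. -/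
def cut (G : SimpleGraph V) [DecidableRel G.Adj] (S T : Finset V) : ℕ :=
  ∑ u ∈ S, (T.filter fun v => G.Adj u v).card

/-- Conductance `φ(S) = |E(S, V \ S)| / μ(S)`. -/
noncomputable def conductance (G : SimpleGraph V) [DecidableRel G.Adj] (S : Finset V) : ℝ :=
  (cut G S Sᶜ : ℝ) / (vol G S : ℝ)

/-- A `k`-way partition of the vertex set into nonempty blocks. -/
def IsKWayPartition {k : ℕ} (P : Fin k → Finset V) : Prop :=
  (∀ i, (P i).Nonempty) ∧ (∀ i j, i ≠ j → Disjoint (P i) (P j)) ∧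
    (∀ v : V, ∃ i, v ∈ P i)

/-- Maximum conductance over the blocks of a tuple of sets. -/
noncomputable def maxCond (G : SimpleGraph V) [DecidableRel G.Adj] {k : ℕ}
    (P : Fin k → Finset V) : ℝ :=
  ⨆ i, conductance G (P i)

/-- Average conductance of the blocks. -/
noncomputable def avgCond (G : SimpleGraph V) [DecidableRel G.Adj] {k : ℕ}
    (P : Fin k → Finset V) : ℝ :=
  (∑ i, conductance G (P i)) / (k : ℝ)

/-- `P` achieves `ρ̂_avr(k)`: it minimizes the maximum conductance among all
`k`-way partitions, and among those it has minimal average conductance. -/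
def AchievesRhoAvr (G : SimpleGraph V) [DecidableRel G.Adj] {k : ℕ}
    (P : Fin k → Finset V) : Prop :=
  IsKWayPartition P ∧
  (∀ Q : Fin k → Finset V, IsKWayPartition Q → maxCond G P ≤ maxCond G Q) ∧
  (∀ Q : Fin k → Finset V, IsKWayPartition Q → maxCond G Q = maxCond G P →
    avgCond G P ≤ avgCond G Q)

/-- Dot product of two vectors indexed by the vertices. -/
def dotV (x y : V → ℝ) : ℝ := ∑ v, x v * y v

/-- The normalized Laplacian `I - D^{-1/2} A D^{-1/2}`. -/
noncomputable def normLap (G : SimpleGraph V) [DecidableRel G.Adj] : Matrix V V ℝ :=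
  1 - Matrix.diagonal (fun v => (Real.sqrt (G.degree v))⁻¹) * G.adjMatrix ℝ *
      Matrix.diagonal (fun v => (Real.sqrt (G.degree v))⁻¹)

/-- `f` is an orthonormal family of eigenvectors of the normalized Laplacian of `G`
with (sorted) eigenvalues `lam`. -/
structure EigenData (G : SimpleGraph V) [DecidableRel G.Adj]
    (f : Fin (Fintype.card V) → V → ℝ) (lam : Fin (Fintype.card V) → ℝ) : Prop where
  eig : ∀ i, (normLap G).mulVec (f i) = lam i • f i
  ortho : ∀ i j, dotV (f i) (f j) = if i = j then (1 : ℝ) else 0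
  mono : Monotone lam

/-- The gap parameter `Ψ = λ_{k+1} / ρ̂_avr(k)`, where `ρ̂_avr(k)` is realized as the
average conductance of the fixed optimal partition `P`. -/
noncomputable def Psi (G : SimpleGraph V) [DecidableRel G.Adj]
    (lam : Fin (Fintype.card V) → ℝ) {k : ℕ} (P : Fin k → Finset V)
    (hkn : k < Fintype.card V) : ℝ :=
  lam ⟨k, hkn⟩ / avgCond G P

/-- The spectral embedding `F(u) = d_u^{-1/2} (f_1(u), …, f_k(u))`. -/
noncomputable def Femb (G : SimpleGraph V) [DecidableRel G.Adj]
    (f : Fin (Fintype.card V) → V → ℝ) {k : ℕ} (hk : k ≤ Fintype.card V) (u : V) :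
    Fin k → ℝ :=
  fun j => f (Fin.castLE hk j) u / Real.sqrt (G.degree u)

/-- `k`-means cost of a clustering of the (degree-weighted) spectral embedding:
`∑_i ∑_{u ∈ A_i} d_u ‖F(u) - c_i‖²`. -/
noncomputable def kmCost (G : SimpleGraph V) [DecidableRel G.Adj]
    (f : Fin (Fintype.card V) → V → ℝ) {k : ℕ} (hk : k ≤ Fintype.card V) {ℓ : ℕ}
    (A : Fin ℓ → Finset V) (c : Fin ℓ → Fin k → ℝ) : ℝ :=
  ∑ i, ∑ u ∈ A i, (G.degree u : ℝ) * ∑ j, (Femb G f hk u j - c i j) ^ 2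

/-- `Δ_ℓ(𝒳_V)`: the optimal `ℓ`-means cost of the spectral embedding multiset `𝒳_V`
(which contains `d_u` copies of `F(u)` for every vertex `u`). -/
noncomputable def kmOpt (G : SimpleGraph V) [DecidableRel G.Adj]
    (f : Fin (Fintype.card V) → V → ℝ) {k : ℕ} (hk : k ≤ Fintype.card V) (ℓ : ℕ) : ℝ :=
  sInf { r : ℝ | ∃ (A : Fin ℓ → Finset V) (c : Fin ℓ → Fin k → ℝ),
    (∀ i j, i ≠ j → Disjoint (A i) (A j)) ∧ (∀ v : V, ∃ i, v ∈ A i) ∧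
    r = kmCost G f hk A c }

/-- Normalized characteristic vector `ḡ_i = D^{1/2} χ_{P_i} / √μ(P_i)`. -/
noncomputable def gbar (G : SimpleGraph V) [DecidableRel G.Adj] {k : ℕ}
    (P : Fin k → Finset V) (i : Fin k) : V → ℝ :=
  fun v => (if v ∈ P i then Real.sqrt (G.degree v) else 0) / Real.sqrt (vol G (P i))

/-- Coefficients `α_j^{(i)} = ⟨ḡ_i, f_j⟩` of `ḡ_i` in the eigenbasis. -/
noncomputable def alpha (G : SimpleGraph V) [DecidableRel G.Adj] {k : ℕ}
    (P : Fin k → Finset V) (f : Fin (Fintype.card V) → V → ℝ)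
    (i : Fin k) (j : Fin (Fintype.card V)) : ℝ :=
  dotV (gbar G P i) (f j)

/-- Projection `f̂_i = ∑_{j=1}^k α_j^{(i)} f_j` of `ḡ_i` onto the first `k` eigenvectors. -/
noncomputable def fhat (G : SimpleGraph V) [DecidableRel G.Adj] {k : ℕ}
    (P : Fin k → Finset V) (f : Fin (Fintype.card V) → V → ℝ) (i : Fin k) : V → ℝ :=
  fun v => ∑ j : Fin (Fintype.card V),
    if (j : ℕ) < k then alpha G P f i j * f j v else 0

/-- Estimation center `p^{(i)} = μ(P_i)^{-1/2} (β_i^{(1)}, …, β_i^{(k)})`;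
here `beta i j` denotes `β_j^{(i)}`. -/
noncomputable def estCenter (G : SimpleGraph V) [DecidableRel G.Adj] {k : ℕ}
    (P : Fin k → Finset V) (beta : Fin k → Fin k → ℝ) (i : Fin k) : Fin k → ℝ :=
  fun j => beta j i / Real.sqrt (vol G (P i))

lemma dotV_eq_sum_dotV_mul_dotV {f : Fin (Fintype.card V) → V → ℝ}
    (hf : ∀ i j, dotV (f i) (f j) = if i = j then (1 : ℝ) else 0) (x y : V → ℝ) :
    dotV x y = ∑ j, dotV x (f j) * dotV y (f j) := by
  let F : Matrix (Fin (Fintype.card V)) V ℝ := Matrix.of f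
  have hF : F * Fᵀ = 1 := by
    ext i j
    rw [Matrix.one_apply, ← hf i j]
    rfl
  have hF' : Fᵀ * F = 1 :=
    (Matrix.mul_eq_one_comm_of_equiv (Fintype.equivFin V).symm).mp hF
  have h : ∀ z : V → ℝ, (fun j => dotV z (f j)) = F *ᵥ z := fun z => by
    ext j
    simp [dotV, F, Matrix.mulVec, dotProduct, mul_comm]
  calc dotV x y = x ⬝ᵥ (Fᵀ * F) *ᵥ y := by rw [hF', Matrix.one_mulVec]; rfl
    _ = (F *ᵥ x) ⬝ᵥ (F *ᵥ y) := by
      rw [← Matrix.mulVec_mulVec, Matrix.dotProduct_mulVec, Matrix.vecMul_transpose]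
    _ = _ := by rw [← h x, ← h y]; rfl

section Laplacian

variable (G : SimpleGraph V) [DecidableRel G.Adj]

lemma isSymm_normLap : (normLap G).IsSymm := by
  simp [Matrix.IsSymm, normLap, Matrix.transpose_mul, Matrix.mul_assoc]

lemma dotV_normLap_mulVec_comm (x y : V → ℝ) :
    dotV ((normLap G).mulVec x) y = dotV x ((normLap G).mulVec y) := by
  change (normLap G *ᵥ x) ⬝ᵥ y = x ⬝ᵥ (normLap G *ᵥ y)
  rw [Matrix.dotProduct_mulVec, ← Matrix.mulVec_transpose, isSymm_normLap G]

variable {G}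

lemma dotV_normLap_mulVec_self (hd : ∀ v : V, 0 < G.degree v) (y : V → ℝ) :
    dotV (fun v => Real.sqrt (G.degree v) * y v)
        ((normLap G).mulVec fun v => Real.sqrt (G.degree v) * y v) =
      (∑ u, ∑ v, if G.Adj u v then (y u - y v) ^ 2 else 0) / 2 := by
  have hs : ∀ v, Real.sqrt (G.degree v) ≠ 0 := fun v =>
    (Real.sqrt_pos.mpr (by exact_mod_cast hd v)).ne'
  rw [← SimpleGraph.lapMatrix_toLinearMap₂', Matrix.toLinearMap₂'_apply']
  have h : (normLap G).mulVec (fun v => Real.sqrt (G.degree v) * y v) =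
      fun v => (Real.sqrt (G.degree v))⁻¹ * (G.lapMatrix ℝ *ᵥ y) v := by
    have h1 : Matrix.diagonal (fun v => (Real.sqrt (G.degree v))⁻¹) *ᵥ
        (fun v => Real.sqrt (G.degree v) * y v) = y := by
      ext v
      rw [Matrix.mulVec_diagonal, inv_mul_cancel_left₀ (hs v)]
    ext v
    rw [normLap, Matrix.sub_mulVec, Matrix.one_mulVec, ← Matrix.mulVec_mulVec,
      ← Matrix.mulVec_mulVec, h1, Pi.sub_apply, Matrix.mulVec_diagonal, SimpleGraph.lapMatrix,
      Matrix.sub_mulVec, Pi.sub_apply, SimpleGraph.degMatrix, Matrix.mulVec_diagonal, mul_sub]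
    congr 1
    have := Real.mul_self_sqrt (Nat.cast_nonneg (α := ℝ) (G.degree v))
    rw [eq_inv_mul_iff_mul_eq₀ (hs v), ← mul_assoc, this]
  rw [h]
  refine Finset.sum_congr rfl fun v _ => ?_
  have := hs v
  field_simp

lemma dotV_normLap_mulVec_self_nonneg (hd : ∀ v : V, 0 < G.degree v) (x : V → ℝ) :
    0 ≤ dotV x ((normLap G).mulVec x) := by
  have hx : x = fun v => Real.sqrt (G.degree v) * (x v / Real.sqrt (G.degree v)) := by
    ext v
    rw [mul_div_cancel₀ _ (Real.sqrt_pos.mpr (by exact_mod_cast hd v)).ne']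
  rw [hx, dotV_normLap_mulVec_self hd]
  refine div_nonneg (Finset.sum_nonneg fun u _ => Finset.sum_nonneg fun v _ => ?_) zero_le_two
  split_ifs <;> positivity

lemma sum_adj_indicator_sub_sq (S : Finset V) :
    (∑ u, ∑ v, if G.Adj u v then
      ((if u ∈ S then (1 : ℝ) else 0) - (if v ∈ S then (1 : ℝ) else 0)) ^ 2 else (0 : ℝ)) =
      2 * (cut G S Sᶜ : ℝ) := by
  have hc : (cut G S Sᶜ : ℝ) = ∑ u, ∑ v, if u ∈ S ∧ v ∉ S ∧ G.Adj u v then (1 : ℝ) else 0 := by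
    simp only [cut, Finset.card_filter, Nat.cast_sum, Nat.cast_ite, Nat.cast_one, Nat.cast_zero,
      ite_and, Finset.sum_ite_irrel, Finset.sum_const_zero, ← Finset.mem_compl,
      Finset.sum_ite_mem, Finset.univ_inter]
  have hc' : (cut G S Sᶜ : ℝ) = ∑ u, ∑ v, if v ∈ S ∧ u ∉ S ∧ G.Adj v u then (1 : ℝ) else 0 := by
    rw [hc, Finset.sum_comm]
  rw [two_mul]
  nth_rewrite 1 [hc]
  rw [hc', ← Finset.sum_add_distrib]
  refine Finset.sum_congr rfl fun u _ => ?_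
  rw [← Finset.sum_add_distrib]
  refine Finset.sum_congr rfl fun v _ => ?_
  by_cases hu : u ∈ S <;> by_cases hv : v ∈ S <;> simp [hu, hv, G.adj_comm v u]

variable {k : ℕ} {P : Fin k → Finset V}

lemma dotV_normLap_mulVec_gbar (hd : ∀ v : V, 0 < G.degree v) (i : Fin k) :
    dotV (gbar G P i) ((normLap G).mulVec (gbar G P i)) = conductance G (P i) := by
  have hg : gbar G P i = fun v => Real.sqrt (G.degree v) *
      ((if v ∈ P i then (1 : ℝ) else 0) / Real.sqrt (vol G (P i))) := by
    ext v
    simp only [gbar]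
    split_ifs <;> ring
  rw [hg, dotV_normLap_mulVec_self hd, conductance]
  simp only [← sub_div, div_pow, Real.sq_sqrt (Nat.cast_nonneg (α := ℝ) (vol G (P i)))]
  have h0 : ∀ (p : Prop) [Decidable p] (a b : ℝ),
      (if p then a / b else 0) = (if p then a else 0) / b := fun p _ a b => by
    split_ifs <;> simp
  simp only [h0, ← Finset.sum_div, sum_adj_indicator_sub_sq]
  ring

lemma dotV_gbar (hd : ∀ v : V, 0 < G.degree v) (hP : IsKWayPartition P) (i j : Fin k) :
    dotV (gbar G P i) (gbar G P j) = if i = j then 1 else 0 := by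
  split_ifs with h
  · subst h
    have hv : (0 : ℝ) < vol G (P i) :=
      Nat.cast_pos.mpr (Finset.sum_pos (fun v _ => hd v) (hP.1 i))
    have : ∀ v, gbar G P i v * gbar G P i v =
        (if v ∈ P i then (G.degree v : ℝ) else 0) / vol G (P i) := fun v => by
      rw [gbar, div_mul_div_comm, Real.mul_self_sqrt hv.le]
      split_ifs <;> simp
    rw [dotV, Finset.sum_congr rfl fun v _ => this v, ← Finset.sum_div, div_eq_one_iff_eq hv.ne']
    simp [vol]
  · refine Finset.sum_eq_zero fun v _ => ?_
    by_cases hi : v ∈ P i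
    · have := Finset.disjoint_left.mp (hP.2.1 i j h) hi
      simp [gbar, this]
    · simp [gbar, hi]

variable {f : Fin (Fintype.card V) → V → ℝ} {lam : Fin (Fintype.card V) → ℝ}

lemma EigenData.lam_nonneg (hf : EigenData G f lam) (hd : ∀ v : V, 0 < G.degree v)
    (j : Fin (Fintype.card V)) : 0 ≤ lam j := by
  have h := dotV_normLap_mulVec_self_nonneg hd (f j)
  have h1 : dotV (f j) (lam j • f j) = lam j * dotV (f j) (f j) := dotProduct_smul _ _ _
  rwa [hf.eig, h1, hf.ortho, if_pos rfl, mul_one] at h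

lemma EigenData.sum_lam_mul_sq (hf : EigenData G f lam) (x : V → ℝ) :
    ∑ j, lam j * dotV x (f j) ^ 2 = dotV x ((normLap G).mulVec x) := by
  rw [dotV_eq_sum_dotV_mul_dotV hf.ortho]
  refine Finset.sum_congr rfl fun j _ => ?_
  have h1 : dotV x (lam j • f j) = lam j * dotV x (f j) := dotProduct_smul _ _ _
  rw [dotV_normLap_mulVec_comm, hf.eig, h1]
  ring

/-- The squared distance from `ḡ_i` to the span of the first `k` eigenvectors is at most
`φ(P_i) / λ_{k+1}`. -/
lemma EigenData.lam_mul_sum_alpha_sq_le (hf : EigenData G f lam) (hd : ∀ v : V, 0 < G.degree v)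
    (hkn : k < Fintype.card V) (i : Fin k) :
    lam ⟨k, hkn⟩ * ∑ j with k ≤ j.val, alpha G P f i j ^ 2 ≤ conductance G (P i) := by
  rw [← dotV_normLap_mulVec_gbar hd, ← hf.sum_lam_mul_sq, Finset.mul_sum]
  calc _ ≤ ∑ j with k ≤ j.val, lam j * alpha G P f i j ^ 2 :=
        Finset.sum_le_sum fun j hj => mul_le_mul_of_nonneg_right
          (hf.mono (Fin.le_def.mpr (Finset.mem_filter.mp hj).2)) (sq_nonneg _)
    _ ≤ _ := Finset.sum_le_sum_of_subset_of_nonneg (Finset.filter_subset _ _)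
        fun j _ _ => mul_nonneg (hf.lam_nonneg hd j) (sq_nonneg _)

lemma conductance_nonneg (S : Finset V) : 0 ≤ conductance G S := by
  unfold conductance
  positivity

lemma sum_conductance_lt_of_sqrt_lt_Psi (hkn : k < Fintype.card V)
    (hPsi : Psi G lam P hkn > Real.sqrt ((k : ℝ) ^ 3)) :
    ∑ i, conductance G (P i) < lam ⟨k, hkn⟩ := by
  have hS : 0 ≤ ∑ i, conductance G (P i) := Finset.sum_nonneg fun i _ => conductance_nonneg _
  have hpos : 0 < Psi G lam P hkn := (Real.sqrt_nonneg _).trans_lt hPsi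
  have hk : k ≠ 0 := by
    rintro rfl
    simp [Psi, avgCond] at hpos
  have hk1 : (1 : ℝ) ≤ k := by exact_mod_cast Nat.one_le_iff_ne_zero.mpr hk
  have havg : 0 < avgCond G P := by
    refine lt_of_le_of_ne (div_nonneg hS (Nat.cast_nonneg k)) fun h => ?_
    simp [Psi, ← h] at hpos
  have hle : (k : ℝ) ≤ Real.sqrt ((k : ℝ) ^ 3) :=
    Real.le_sqrt_of_sq_le (pow_le_pow_right₀ hk1 (by norm_num))
  have h := (lt_div_iff₀ havg).mp (hle.trans_lt hPsi)
  rwa [avgCond, mul_div_cancel₀ _ (by positivity)] at h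

lemma EigenData.eq_zero_of_sum_mul_alpha_eq_zero (hf : EigenData G f lam)
    (hd : ∀ v : V, 0 < G.degree v) (hP : IsKWayPartition P) (hkn : k < Fintype.card V)
    (hlam : ∑ i, conductance G (P i) < lam ⟨k, hkn⟩) {c : Fin k → ℝ}
    (hc : ∀ j : Fin (Fintype.card V), j.val < k → ∑ i, c i * alpha G P f i j = 0) : c = 0 := by
  have hnorm : ∑ i, c i ^ 2 = ∑ j, (∑ i, c i * alpha G P f i j) ^ 2 := by
    have hg : ∀ i i', (∑ j, alpha G P f i j * alpha G P f i' j) = if i = i' then 1 else 0 :=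
      fun i i' => by
        rw [← dotV_gbar hd hP i i', dotV_eq_sum_dotV_mul_dotV hf.ortho]
        rfl
    calc ∑ i, c i ^ 2 = ∑ i, ∑ i', c i * c i' * ∑ j, alpha G P f i j * alpha G P f i' j := by
          simp [hg, sq]
      _ = ∑ j, ∑ i, ∑ i', c i * c i' * (alpha G P f i j * alpha G P f i' j) := by
          simp only [Finset.mul_sum]
          rw [Finset.sum_comm]
          refine (Finset.sum_congr rfl fun i' _ => Finset.sum_comm).trans ?_
          rw [Finset.sum_comm]
          exact Finset.sum_congr rfl fun j _ => Finset.sum_comm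
      _ = _ := by
          refine Finset.sum_congr rfl fun j _ => ?_
          rw [sq, Finset.sum_mul_sum]
          exact Finset.sum_congr rfl fun i _ => Finset.sum_congr rfl fun i' _ => by ring
  have htail : ∑ i, c i ^ 2 ≤
      (∑ i, c i ^ 2) * ∑ i, ∑ j with k ≤ j.val, alpha G P f i j ^ 2 := by
    nth_rewrite 1 [hnorm]
    rw [Finset.sum_comm, Finset.mul_sum, Finset.sum_filter]
    refine Finset.sum_le_sum fun j _ => ?_
    split_ifs with hj
    · exact Finset.sum_mul_sq_le_sq_mul_sq Finset.univ c fun i => alpha G P f i j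
    · rw [hc j (not_le.mp hj)]
      simp
  have hsum : lam ⟨k, hkn⟩ * ∑ i, ∑ j with k ≤ j.val, alpha G P f i j ^ 2 <
      lam ⟨k, hkn⟩ := by
    refine lt_of_le_of_lt ?_ hlam
    rw [Finset.mul_sum]
    exact Finset.sum_le_sum fun i _ => hf.lam_mul_sum_alpha_sq_le hd hkn i
  have hlt : ∑ i, ∑ j with k ≤ j.val, alpha G P f i j ^ 2 < 1 := by
    by_contra! h
    exact absurd (le_mul_of_one_le_right (hf.lam_nonneg hd _) h) (not_le.mpr hsum)
  have hnn : 0 ≤ ∑ i, c i ^ 2 := Finset.sum_nonneg fun i _ => sq_nonneg _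
  have hzero : ∑ i, c i ^ 2 = 0 := by nlinarith
  ext i
  exact pow_eq_zero_iff two_ne_zero |>.mp
    ((Finset.sum_eq_zero_iff_of_nonneg fun i _ => sq_nonneg (c i)).mp hzero i (Finset.mem_univ i))

lemma fhat_eq_sum_castLE (hk : k ≤ Fintype.card V) (i : Fin k) :
    fhat G P f i = ∑ j : Fin k, alpha G P f i (Fin.castLE hk j) • f (Fin.castLE hk j) := by
  ext v
  simp only [fhat, Finset.sum_apply, Pi.smul_apply, smul_eq_mul]
  rw [← Finset.sum_filter]
  symm
  refine Finset.sum_bij (fun j _ => Fin.castLE hk j) (by simp) (by simp) (fun j hj => ?_)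
    (fun _ _ => rfl)
  exact ⟨⟨j, (Finset.mem_filter.mp hj).2⟩, Finset.mem_univ _, rfl⟩

end Laplacian

theorem span_fhat_eq_span_f
    {V : Type} [Fintype V] [DecidableEq V] (G : SimpleGraph V) [DecidableRel G.Adj]
    (hd : ∀ v : V, 0 < G.degree v)
    {k : ℕ} (hkn : k < Fintype.card V)
    (f : Fin (Fintype.card V) → V → ℝ) (lam : Fin (Fintype.card V) → ℝ)
    (hf : EigenData G f lam)
    (P : Fin k → Finset V) (hP : AchievesRhoAvr G P)
    (hPsi : Psi G lam P hkn > Real.sqrt ((k : ℝ) ^ 3)) :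
    Submodule.span ℝ (Set.range (fhat G P f)) =
        Submodule.span ℝ (Set.range fun i : Fin k => f (Fin.castLE hkn.le i)) ∧
      ∃ beta : Fin k → Fin k → ℝ, ∀ i : Fin k,
        f (Fin.castLE hkn.le i) = fun v => ∑ j : Fin k, beta i j * fhat G P f j v := by
  let A : Matrix (Fin k) (Fin k) ℝ := Matrix.of fun i j => alpha G P f i (Fin.castLE hkn.le j)
  have hA : IsUnit A := by
    rw [← Matrix.vecMul_injective_iff_isUnit]
    refine (injective_iff_map_eq_zero A.vecMulLinear).mpr fun c hc => ?_
    exact hf.eq_zero_of_sum_mul_alpha_eq_zero hd hP.1 hkn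
      (sum_conductance_lt_of_sqrt_lt_Psi hkn hPsi) fun j hj => congrFun hc ⟨j, hj⟩
  have hAinv : A⁻¹ * A = 1 := Matrix.nonsing_inv_mul A ((Matrix.isUnit_iff_isUnit_det A).mp hA)
  have hinv : ∀ i : Fin k, f (Fin.castLE hkn.le i) = ∑ j, A⁻¹ i j • fhat G P f j := fun i => by
    calc f (Fin.castLE hkn.le i)
        = ∑ l, (A⁻¹ * A) i l • f (Fin.castLE hkn.le l) := by
          simp [hAinv, Matrix.one_apply]
      _ = _ := by
          simp only [fhat_eq_sum_castLE hkn.le, Matrix.mul_apply, Finset.sum_smul,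
            Finset.smul_sum, smul_smul]
          rw [Finset.sum_comm]
          rfl
  refine ⟨le_antisymm ?_ ?_, (A⁻¹ : Matrix (Fin k) (Fin k) ℝ), fun i => ?_⟩
  · rw [Submodule.span_le]
    rintro _ ⟨i, rfl⟩
    rw [fhat_eq_sum_castLE hkn.le]
    exact Submodule.sum_mem _ fun j _ => Submodule.smul_mem _ _ (Submodule.subset_span ⟨j, rfl⟩)
  · rw [Submodule.span_le]
    rintro _ ⟨i, rfl⟩
    simp only [hinv i]
    exact Submodule.sum_mem _ fun j _ => Submodule.smul_mem _ _ (Submodule.subset_span ⟨j, rfl⟩)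
  · ext v
    simp only [hinv i, Finset.sum_apply, Pi.smul_apply, smul_eq_mul]


end SpectralClustering
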